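/- arXiv:2304.12699 — 5 statements merged into one kernel-verified Lean document; each statement's English description precedes it below -/
import Mathlib

section
/- Let d ≥ 2 be an integer, and let g : ℝ → ℝ be a continuous, strictly increasing function satisfying g(x + 1) = g(x) + 1 for all x ∈ ℝ, g(0) = 0, and g(d·x) − d·g(x) ∈ ℤ for all x ∈ ℝ. Then g(x) = x for all x ∈ ℝ. -/
/-- A continuous real function on a preconnected space that takes only integer values
is constant. -/
theorem Continuous.eq_of_forall_exists_intCast {X : Type*} [TopologicalSpace X]
    [PreconnectedSpace X] {f : X → ℝ} (hf : Continuous f) (hint : ∀ x, ∃ m : ℤ, f x = m)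
    (x y : X) : f x = f y := by
  choose m hm using hint
  have hmf : f = Int.cast ∘ m := funext hm
  have hmc : Continuous m :=
    Int.isClosedEmbedding_coe_real.isInducing.continuous_iff.2 (hmf ▸ hf)
  rw [hm x, hm y, PreconnectedSpace.constant ‹_› hmc]

/-- A bounded real function satisfying `f (a * x) = a * f x` for some `a > 1` vanishes. -/
theorem eq_zero_of_map_mul_of_abs_le {f : ℝ → ℝ} {a C : ℝ} (ha : 1 < a)
    (hf : ∀ x, f (a * x) = a * f x) (hC : ∀ x, |f x| ≤ C) (x : ℝ) : f x = 0 := by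
  have hpow (n : ℕ) : f (a ^ n * x) = a ^ n * f x := by
    induction n with
    | zero => simp
    | succ n ih => rw [pow_succ', mul_assoc, hf, ih, mul_assoc]
  by_contra hx
  have hpos : 0 < |f x| := abs_pos.2 hx
  obtain ⟨n, hn⟩ := pow_unbounded_of_one_lt (C / |f x|) ha
  have hle := hC (a ^ n * x)
  rw [hpow, abs_mul, abs_of_pos (pow_pos (zero_lt_one.trans ha) n)] at hle
  exact absurd hle (not_le.2 ((div_lt_iff₀ hpos).1 hn))

/-- A degree one circle lift fixing `0` moves every point by at most `1`. -/
theorem CircleDeg1Lift.abs_map_sub_self_le_one (f : CircleDeg1Lift) (h0 : f 0 = 0) (x : ℝ) :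
    |f x - x| ≤ 1 := by
  have hupper := f.map_le_of_map_zero x
  have hlower := f.le_map_of_map_zero x
  rw [abs_le]
  constructor <;> linarith [Int.ceil_lt_add_one x, Int.sub_one_lt_floor x]


/-- An orientation-preserving circle homeomorphism commuting with the angle-multiplication
map `m_d` and fixing the basepoint is the identity, stated in terms of a lift `g : ℝ → ℝ`:
`g` is continuous, strictly increasing, satisfies `g (x + 1) = g x + 1`, `g 0 = 0`, and
`g (d·x) − d·g x ∈ ℤ` for all `x`.  Then `g = id`. -/
theorem circle_homeo_commuting_with_mul_d_eq_id
    (d : ℕ) (hd : 2 ≤ d) (g : ℝ → ℝ)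
    (hcont : Continuous g) (hmono : StrictMono g)
    (hlift : ∀ x : ℝ, g (x + 1) = g x + 1)
    (h0 : g 0 = 0)
    (hcomm : ∀ x : ℝ, ∃ m : ℤ, g ((d : ℝ) * x) - (d : ℝ) * g x = (m : ℝ)) :
    ∀ x : ℝ, g x = x := by
  have hd1 : (1 : ℝ) < d := by exact_mod_cast hd
  have hmul (x : ℝ) : g (d * x) = d * g x := by
    have hconst := Continuous.eq_of_forall_exists_intCast
      (f := fun x => g (d * x) - d * g x) (by fun_prop) hcomm x 0
    simpa [h0, sub_eq_zero] using hconst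
  intro x
  refine sub_eq_zero.1 (eq_zero_of_map_mul_of_abs_le (f := fun x => g x - x) hd1
    (fun y => ?_) (CircleDeg1Lift.abs_map_sub_self_le_one ⟨⟨g, hmono.monotone⟩, hlift⟩ h0) x)
  rw [hmul, mul_sub]
end

section
/- Let X be a set, let N ≥ 2 be an integer, and let η, τ : X → X be bijections with η ∘ η = id and τ^N = id. Suppose there exist a nonempty subset A ⊆ X and a function ρ : A → ℕ such that: (i) for every integer k with 1 ≤ k ≤ N − 1 and every x ∈ A, the point τ^k(η(x)) lies in A and ρ(τ^k(η(x))) = ρ(x) + 1; and (ii) η(x) ∉ A for every x ∈ A. Then the group homomorphism from the free product (ℤ/2ℤ) ∗ (ℤ/Nℤ) to the group of bijections of X, sending the generator of ℤ/2ℤ to η and a fixed generator of ℤ/Nℤ to τ, is injective. In particular, the subgroup generated by η and τ in the group of bijections of X is isomorphic to (ℤ/2ℤ) ∗ (ℤ/Nℤ). -/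
open Monoid.Coprod in
/-- The submonoid of `G ∗ H` consisting of the products of factors `y * x` with `1 ≠ x` in `G`
and `1 ≠ y` in `H`. -/
def Monoid.Coprod.alternating (G H : Type*) [Group G] [Group H] : Submonoid (Monoid.Coprod G H) :=
  Submonoid.closure {w | ∃ x : G, x ≠ 1 ∧ ∃ y : H, y ≠ 1 ∧ w = inr y * inl x}

namespace Monoid.Coprod

variable {G H X : Type*} [Group G] [Group H]

theorem inr_mul_inl_mul_mem_alternating {x : G} {y : H} (hx : x ≠ 1) (hy : y ≠ 1)
    {w : Monoid.Coprod G H} (hw : w ∈ alternating G H) :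
    inr y * inl x * w ∈ alternating G H :=
  mul_mem (Submonoid.subset_closure ⟨x, hx, y, hy, rfl⟩) hw

theorem eq_one_or_eq_mul_of_mem_alternating {w : Monoid.Coprod G H} (hw : w ∈ alternating G H) :
    w = 1 ∨ ∃ x : G, x ≠ 1 ∧ ∃ y : H, y ≠ 1 ∧ ∃ v ∈ alternating G H,
      w = inr y * inl x * v := by
  induction hw using Submonoid.closure_induction_left with
  | one => exact .inl rfl
  | mul_left z hz v hv _ =>
    obtain ⟨x, hx, y, hy, rfl⟩ := hz
    exact .inr ⟨x, hx, y, hy, v, hv, rfl⟩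

theorem exists_eq_inl_mul_alternating_mul_inr (g : Monoid.Coprod G H) :
    ∃ a : G, ∃ w ∈ alternating G H, ∃ b : H, g = inl a * w * inr b := by
  induction g using Monoid.Coprod.induction_on' with
  | one => exact ⟨1, 1, one_mem _, 1, by simp⟩
  | inl_mul x g ih =>
    obtain ⟨a, w, hw, b, rfl⟩ := ih
    exact ⟨x * a, w, hw, b, by simp [mul_assoc]⟩
  | inr_mul y g ih =>
    obtain ⟨a, w, hw, b, rfl⟩ := ih
    by_cases hy : y = 1
    · exact ⟨a, w, hw, b, by simp [hy]⟩
    by_cases ha : a = 1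
    · subst ha
      obtain rfl | ⟨x, hx, z, -, v, hv, rfl⟩ := eq_one_or_eq_mul_of_mem_alternating hw
      · exact ⟨1, 1, one_mem _, y * b, by simp⟩
      by_cases hyz : y * z = 1
      · exact ⟨x, v, hv, b, by simp [← mul_assoc, ← map_mul, hyz]⟩
      · exact ⟨1, _, inr_mul_inl_mul_mem_alternating hx hyz hv, b, by simp [mul_assoc]⟩
    · exact ⟨1, _, inr_mul_inl_mul_mem_alternating ha hy hw, b, by simp [mul_assoc]⟩

/-- A ping-pong lemma for the free product of two groups, in which one of the two ping-pong sets
is replaced by a rank function. -/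
theorem injective_of_rank_lt [Nontrivial G] (f : Monoid.Coprod G H →* Equiv.Perm X)
    {A : Set X} (hA : A.Nonempty) (ρ : X → ℕ)
    (hrank : ∀ x : G, x ≠ 1 → ∀ y : H, y ≠ 1 → ∀ p ∈ A,
      f (inr y) (f (inl x) p) ∈ A ∧ ρ p < ρ (f (inr y) (f (inl x) p)))
    (hoff : ∀ x : G, x ≠ 1 → ∀ p ∈ A, f (inl x) p ∉ A) :
    Function.Injective f := by
  obtain ⟨p, hp⟩ := hA
  have maps {w} (hw : w ∈ alternating G H) : f w p ∈ A ∧ ρ p ≤ ρ (f w p) := by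
    induction hw using Submonoid.closure_induction_left with
    | one => simpa using hp
    | mul_left z hz v _ ih =>
      obtain ⟨x, hx, y, hy, rfl⟩ := hz
      have := hrank x hx y hy _ ih.1
      simp only [map_mul, Equiv.Perm.mul_apply]
      exact ⟨this.1, ih.2.trans this.2.le⟩
  have rank_ne {x : G} (hx : x ≠ 1) {y : H} (hy : y ≠ 1) {v} (hv : v ∈ alternating G H) :
      f (inr y * inl x * v) ≠ 1 := fun h ↦ by
    have hlt := (hrank x hx y hy _ (maps hv).1).2
    have hfix : f (inr y) (f (inl x) (f v p)) = p := by
      simpa using DFunLike.congr_fun h p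
    rw [hfix] at hlt
    exact hlt.not_ge (maps hv).2
  have inl_ne {x : G} (hx : x ≠ 1) {v} (hv : v ∈ alternating G H) :
      f (inl x * v) ≠ 1 := fun h ↦ by
    refine hoff x hx _ (maps hv).1 ?_
    have hfix : f (inl x) (f v p) = p := by simpa using DFunLike.congr_fun h p
    rwa [hfix]
  rw [injective_iff_map_eq_one]
  intro g hg
  obtain ⟨a, w, hw, b, rfl⟩ := exists_eq_inl_mul_alternating_mul_inr g
  have hconj : f (inr b * inl a * w) = 1 := by
    simp only [map_mul] at hg ⊢
    rw [mul_assoc]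
    exact mul_eq_one_comm.mp hg
  by_cases hb : b = 1
  · subst hb
    by_cases ha : a = 1
    · subst ha
      obtain rfl | ⟨x, hx, y, hy, v, hv, rfl⟩ := eq_one_or_eq_mul_of_mem_alternating hw
      · simp
      · exact absurd (by simpa using hconj) (rank_ne hx hy hv)
    · exact absurd (by simpa using hconj) (inl_ne ha hw)
  by_cases ha : a = 1
  · subst ha
    exfalso
    obtain rfl | ⟨x, hx, y, -, v, hv, rfl⟩ := eq_one_or_eq_mul_of_mem_alternating hw
    · obtain ⟨x, hx⟩ := exists_ne (1 : G)
      have hfb : f (inr b) = 1 := by simpa using hconj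
      have := (hrank x hx b hb p hp).1
      rw [hfb] at this
      exact hoff x hx p hp this
    · have hby : f (inr (b * y) * inl x * v) = 1 := by simpa [mul_assoc] using hconj
      by_cases h : b * y = 1
      · exact inl_ne hx hv (by simpa [h] using hby)
      · exact rank_ne hx h hv hby
  · exact absurd hconj (rank_ne ha hb hw)

end Monoid.Coprod

theorem map_ofAdd_one_pow_val {M : Type*} [Monoid M] {n : ℕ} [NeZero n]
    (f : Multiplicative (ZMod n) →* M) (y : Multiplicative (ZMod n)) :
    f (Multiplicative.ofAdd 1) ^ y.toAdd.val = f y := by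
  rw [← map_pow, ← ofAdd_nsmul]
  simp

theorem exists_monoidHom_zmod_of_pow_eq_one {K : Type*} [Group K] {n : ℕ} {t : K}
    (ht : t ^ n = 1) :
    ∃ f : Multiplicative (ZMod n) →* K, f (Multiplicative.ofAdd 1) = t := by
  let f := ZMod.lift n ⟨(zpowersHom K t).toAdditiveRight,
    by simpa using congrArg Additive.ofMul ht⟩
  refine ⟨f.toMultiplicativeLeft, ?_⟩
  have h : f 1 = Additive.ofMul t := by
    rw [← Int.cast_one, ZMod.lift_coe]
    simp
  exact congrArg Additive.toMul h

theorem range_eq_closure_pair {K : Type*} [Group K] {m n : ℕ} [NeZero m] [NeZero n]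
    (f : Monoid.Coprod (Multiplicative (ZMod m)) (Multiplicative (ZMod n)) →* K) :
    f.range = Subgroup.closure {f (.inl (Multiplicative.ofAdd 1)),
      f (.inr (Multiplicative.ofAdd 1))} := by
  rw [Monoid.Coprod.range_eq]
  apply le_antisymm
  · refine sup_le ?_ ?_ <;> rintro _ ⟨y, rfl⟩
    · rw [← map_ofAdd_one_pow_val (f.comp Monoid.Coprod.inl) y]
      exact Subgroup.pow_mem _ (Subgroup.subset_closure (.inl rfl)) _
    · rw [← map_ofAdd_one_pow_val (f.comp Monoid.Coprod.inr) y]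
      exact Subgroup.pow_mem _ (Subgroup.subset_closure (.inr rfl)) _
  · rw [Subgroup.closure_le, Set.pair_subset_iff]
    exact ⟨Subgroup.mem_sup_left ⟨_, rfl⟩, Subgroup.mem_sup_right ⟨_, rfl⟩⟩

/-- The rank-based ping-pong argument of Proposition 5.4: let `η, τ` be bijections of a
set `X` with `η² = id` and `τ^N = id`, and suppose there are a nonempty set `A ⊆ X` and a
rank function `ρ` such that every branch `τ^k ∘ η` (`1 ≤ k ≤ N−1`) maps `A` into `A`
increasing the rank by one, while `η` maps `A` off itself.  Then the homomorphism from
the free product `(ℤ/2ℤ) ∗ (ℤ/Nℤ)` to the group of bijections of `X` sending the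
generators to `η` and `τ` is injective; in particular the subgroup generated by `η` and
`τ` is isomorphic to `(ℤ/2ℤ) ∗ (ℤ/Nℤ)`. -/
theorem pingpong_free_product
    {X : Type*} (N : ℕ) (hN : 2 ≤ N)
    (η τ : Equiv.Perm X) (hη : η * η = 1) (hτ : τ ^ N = 1)
    (A : Set X) (hA : A.Nonempty) (ρ : X → ℕ)
    (hrank : ∀ k : ℕ, 1 ≤ k → k ≤ N - 1 → ∀ x ∈ A,
      (τ ^ k) (η x) ∈ A ∧ ρ ((τ ^ k) (η x)) = ρ x + 1)
    (hoff : ∀ x ∈ A, η x ∉ A) :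
    (∀ φ : Monoid.Coprod (Multiplicative (ZMod 2)) (Multiplicative (ZMod N)) →* Equiv.Perm X,
        φ (Monoid.Coprod.inl (Multiplicative.ofAdd (1 : ZMod 2))) = η →
        φ (Monoid.Coprod.inr (Multiplicative.ofAdd (1 : ZMod N))) = τ →
        Function.Injective φ) ∧
    Nonempty (Monoid.Coprod (Multiplicative (ZMod 2)) (Multiplicative (ZMod N)) ≃*
      Subgroup.closure ({η, τ} : Set (Equiv.Perm X))) := by
  have : NeZero N := ⟨by omega⟩
  have hinj (φ : Monoid.Coprod (Multiplicative (ZMod 2)) (Multiplicative (ZMod N)) →*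
      Equiv.Perm X) (h₁ : φ (.inl (Multiplicative.ofAdd 1)) = η)
      (h₂ : φ (.inr (Multiplicative.ofAdd 1)) = τ) : Function.Injective φ := by
    have hinl (x : Multiplicative (ZMod 2)) (hx : x ≠ 1) : φ (.inl x) = η := by
      have : x = Multiplicative.ofAdd 1 := by revert x; decide
      rw [this, h₁]
    have hinr (y : Multiplicative (ZMod N)) : φ (.inr y) = τ ^ y.toAdd.val := by
      rw [← h₂]
      exact (map_ofAdd_one_pow_val (φ.comp Monoid.Coprod.inr) y).symm
    refine Monoid.Coprod.injective_of_rank_lt φ hA ρ (fun x hx y hy p hp ↦ ?_)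
      fun x hx p hp ↦ by simpa [hinl x hx] using hoff p hp
    have hy₀ : y.toAdd.val ≠ 0 := by simpa [ZMod.val_eq_zero] using hy
    have hyN := ZMod.val_lt y.toAdd
    have := hrank y.toAdd.val (by omega) (by omega) p hp
    rw [hinl x hx, hinr]
    exact ⟨this.1, by omega⟩
  refine ⟨hinj, ?_⟩
  obtain ⟨f, hf⟩ := exists_monoidHom_zmod_of_pow_eq_one (n := 2) ((sq η).trans hη)
  obtain ⟨g, hg⟩ := exists_monoidHom_zmod_of_pow_eq_one hτ
  let φ := Monoid.Coprod.lift f g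
  have h₁ : φ (.inl (Multiplicative.ofAdd 1)) = η := by simpa [φ] using hf
  have h₂ : φ (.inr (Multiplicative.ofAdd 1)) = τ := by simpa [φ] using hg
  have hrange := range_eq_closure_pair φ
  rw [h₁, h₂] at hrange
  exact ⟨(φ.ofInjective (hinj φ h₁ h₂)).trans (MulEquiv.subgroupCongr hrange)⟩
end

section
/- Let q ≥ 2 be an integer, let a₁, …, a_{2q−1} ∈ ℂ, and let c₁, …, c_{q−1} ∈ ℂ ∖ {0}. Suppose the polynomial identity X^{2q} − Σ_{j=1}^{2q−1} j·a_j·X^{2q−1−j} = (X − 1)(X + 1)·∏_{i=1}^{q−1} (X − c_i)(X − c_i⁻¹) holds in ℂ[X]. Then a_{q−1} = 0, a_{2q−2} = 0, a_{2q−1} = 1/(2q−1), and a_{2q−j−1} = −((j−1)/(2q−j−1))·a_{j−1} for every j ∈ {2, …, q−1}. -/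
open Polynomial Finset

theorem reflect_X_sub_C_mul_X_sub_C_inv {c : ℂ} (hc : c ≠ 0) :
    reflect 2 ((X - C c) * (X - C c⁻¹)) = (X - C c) * (X - C c⁻¹) := by
  have h : (X - C c) * (X - C c⁻¹) = C 1 * X ^ 2 + C (-(c + c⁻¹)) * X ^ 1 + C 1 * X ^ 0 := by
    have h1 : C c * C c⁻¹ = 1 := by rw [← C_mul, mul_inv_cancel₀ hc, C_1]
    simp only [map_neg, map_add, map_one]
    linear_combination h1
  rw [h]
  simp only [reflect_add, reflect_C_mul_X_pow]
  rw [revAt_le le_rfl, revAt_le one_le_two, revAt_le (Nat.zero_le 2)]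
  ring

theorem natDegree_le_and_reflect_prod_X_sub_C_mul_X_sub_C_inv (s : Finset ℕ) (c : ℕ → ℂ)
    (hc : ∀ i ∈ s, c i ≠ 0) :
    (∏ i ∈ s, ((X - C (c i)) * (X - C (c i)⁻¹))).natDegree ≤ 2 * #s ∧
      reflect (2 * #s) (∏ i ∈ s, ((X - C (c i)) * (X - C (c i)⁻¹))) =
        ∏ i ∈ s, ((X - C (c i)) * (X - C (c i)⁻¹)) := by
  induction s using Finset.induction_on with
  | empty => simp [reflect_one]
  | insert i s hi ih =>
    obtain ⟨hdeg, hrefl⟩ := ih fun j hj => hc j (mem_insert_of_mem hj)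
    have h2 : ((X - C (c i)) * (X - C (c i)⁻¹)).natDegree ≤ 2 := by compute_degree
    rw [prod_insert hi, card_insert_of_notMem hi, mul_add_one, add_comm (2 * #s)]
    exact ⟨natDegree_mul_le_of_le h2 hdeg, by
      rw [reflect_mul _ _ h2 hdeg, hrefl,
        reflect_X_sub_C_mul_X_sub_C_inv (hc i (mem_insert_self i s))]⟩

theorem reflect_X_sub_one_mul_X_add_one :
    reflect 2 ((X - 1) * (X + 1) : ℂ[X]) = -((X - 1) * (X + 1)) := by
  have h : ((X - 1) * (X + 1) : ℂ[X]) = C 1 * X ^ 2 + C (-1) * X ^ 0 := by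
    simp only [map_neg, map_one]
    ring
  rw [h]
  simp only [reflect_add, reflect_C_mul_X_pow]
  rw [revAt_le le_rfl, revAt_le (Nat.zero_le 2)]
  simp only [map_neg, map_one]
  ring

/-- Coefficient relations (6.1)–(6.2) of the paper: if the critical-point polynomial
`X^{2q} − Σ_{j=1}^{2q−1} j·a_j·X^{2q−1−j}` factors as
`(X − 1)(X + 1)·∏_{i=1}^{q−1} (X − c_i)(X − c_i⁻¹)` with all `c_i ≠ 0`, then
`a_{q−1} = 0`, `a_{2q−2} = 0`, `a_{2q−1} = 1/(2q−1)`, and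
`a_{2q−j−1} = −((j−1)/(2q−j−1))·a_{j−1}` for `2 ≤ j ≤ q−1`. -/
theorem bers_slice_coefficient_relations_even
    (q : ℕ) (hq : 2 ≤ q) (a : ℕ → ℂ) (c : ℕ → ℂ)
    (hc : ∀ i, 1 ≤ i → i ≤ q - 1 → c i ≠ 0)
    (hid : (X : ℂ[X]) ^ (2 * q) -
        ∑ j ∈ Icc 1 (2 * q - 1), C ((j : ℂ) * a j) * X ^ (2 * q - 1 - j) =
      (X - 1) * (X + 1) *
        ∏ i ∈ Icc 1 (q - 1), ((X - C (c i)) * (X - C (c i)⁻¹))) :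
    a (q - 1) = 0 ∧ a (2 * q - 2) = 0 ∧ a (2 * q - 1) = 1 / (2 * (q : ℂ) - 1) ∧
    ∀ j : ℕ, 2 ≤ j → j ≤ q - 1 →
      a (2 * q - j - 1) = -(((j : ℂ) - 1) / (2 * (q : ℂ) - (j : ℂ) - 1)) * a (j - 1) := by
  set P : ℂ[X] := X ^ (2 * q) -
    ∑ j ∈ Icc 1 (2 * q - 1), C ((j : ℂ) * a j) * X ^ (2 * q - 1 - j) with hP
  have hrefl : reflect (2 * q) P = -P := by
    obtain ⟨hdeg, hprod⟩ := natDegree_le_and_reflect_prod_X_sub_C_mul_X_sub_C_inv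
      (Icc 1 (q - 1)) c fun i hi => hc i (mem_Icc.1 hi).1 (mem_Icc.1 hi).2
    have h2 : ((X - 1) * (X + 1) : ℂ[X]).natDegree ≤ 2 := by compute_degree
    have hq2 : 2 * q = 2 + 2 * #(Icc 1 (q - 1)) := by
      rw [Nat.card_Icc]
      omega
    rw [hid, hq2, reflect_mul _ _ h2 hdeg, hprod, reflect_X_sub_one_mul_X_add_one, neg_mul]
  have hanti : ∀ k ≤ 2 * q, P.coeff (2 * q - k) = -P.coeff k := fun k hk => by
    rw [← revAt_le hk, ← coeff_reflect, hrefl, coeff_neg]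
  have hcoeff : ∀ j k, j + k = 2 * q - 1 → P.coeff k = -(j * a j) := fun j k hjk => by
    have hk : k ≠ 2 * q := by omega
    rw [hP, coeff_sub, coeff_X_pow, if_neg hk, finsetSum_coeff, zero_sub]
    simp only [coeff_C_mul_X_pow]
    congr 1
    rw [sum_eq_single j]
    · rw [if_pos (by omega)]
    · intro i hi hij
      rw [mem_Icc] at hi
      rw [if_neg (by omega)]
    · intro hj
      rw [mem_Icc] at hj
      have hj0 : j = 0 := by omega
      simp [hj0]
  have htop : P.coeff (2 * q) = 1 := by
    rw [hP, coeff_sub, coeff_X_pow, if_pos rfl, finsetSum_coeff, sub_eq_self]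
    refine sum_eq_zero fun i hi => ?_
    rw [coeff_C_mul_X_pow, if_neg (by omega)]
  have hrel : ∀ j, 1 ≤ j → j ≤ 2 * q - 1 →
      (2 * (q : ℂ) - j - 1) * a (2 * q - j - 1) = -(((j : ℂ) - 1) * a (j - 1)) := by
    intro j hj1 hj2
    have h := hanti j (by omega)
    rw [hcoeff (j - 1) (2 * q - j) (by omega), hcoeff (2 * q - j - 1) j (by omega),
      Nat.cast_sub (by omega), Nat.cast_sub (by omega), Nat.cast_sub (by omega)] at h
    push_cast at h
    linear_combination -h
  have hne : ∀ j : ℕ, j + 1 < 2 * q → 2 * (q : ℂ) - j - 1 ≠ 0 := fun j hj h => by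
    have : ((2 * q : ℕ) : ℂ) = ((j + 1 : ℕ) : ℂ) := by
      push_cast
      linear_combination h
    exact hj.ne' (Nat.cast_injective this)
  refine ⟨?_, ?_, ?_, fun j hj1 hj2 => ?_⟩
  · have h := hrel q (by omega) (by omega)
    rw [show 2 * q - q - 1 = q - 1 by omega] at h
    have h0 : (2 * (q : ℂ) - q - 1) * a (q - 1) = 0 := by linear_combination h / 2
    exact (mul_eq_zero.1 h0).resolve_left (hne q (by omega))
  · have h := hrel 1 le_rfl (by omega)
    rw [show 2 * q - 1 - 1 = 2 * q - 2 by omega, Nat.cast_one, sub_self, zero_mul, neg_zero] at h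
    exact (mul_eq_zero.1 h).resolve_left (by simpa using hne 1 (by omega))
  · have h := hanti 0 (Nat.zero_le _)
    rw [Nat.sub_zero, htop, hcoeff (2 * q - 1) 0 (by omega), Nat.cast_sub (by omega)] at h
    push_cast at h
    have h0 : 2 * (q : ℂ) - 1 ≠ 0 := by simpa using hne 0 (by omega)
    rw [eq_div_iff h0]
    linear_combination -h
  · have h0 := hne j (by omega)
    have h := hrel j (by omega) (by omega)
    field_simp
    linear_combination h
end

section
/- Let q ≥ 2 be an integer, let a₁, …, a_{2q} ∈ ℂ, and let c₁, …, c_q ∈ ℂ ∖ {0}. Suppose the polynomial identity X^{2q+1} − Σ_{j=1}^{2q} j·a_j·X^{2q−j} = (X − 1)·∏_{i=1}^{q} (X − c_i)(X − c_i⁻¹) holds in ℂ[X]. Then a_{2q−1} = 0, a_{2q} = 1/(2q), and a_{2q−j} = −((j−1)/(2q−j))·a_{j−1} for every j ∈ {2, …, q}. -/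
open Polynomial Finset

theorem X_sub_C_mul_X_sub_C_inv {K : Type*} [Field K] {x : K} (hx : x ≠ 0) :
    (X - C x) * (X - C x⁻¹) = (X ^ 2 - C (x + x⁻¹) * X ^ 1 + X ^ 0 : K[X]) := by
  have h : (C x * C x⁻¹ : K[X]) = 1 := by rw [← C_mul, mul_inv_cancel₀ hx, C_1]
  rw [C_add]
  linear_combination h

theorem natDegree_quadratic_le {K : Type*} [Field K] (x : K) :
    ((X - C x) * (X - C x⁻¹)).natDegree ≤ 2 :=
  natDegree_mul_le_of_le (natDegree_X_sub_C_le x) (natDegree_X_sub_C_le x⁻¹)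

theorem reflect_quadratic {K : Type*} [Field K] {x : K} (hx : x ≠ 0) :
    reflect 2 ((X - C x) * (X - C x⁻¹)) = (X - C x) * (X - C x⁻¹) := by
  rw [X_sub_C_mul_X_sub_C_inv hx, reflect_add, reflect_sub, reflect_C_mul_X_pow, reflect_monomial,
    reflect_monomial, revAt_le le_rfl, revAt_le one_le_two, revAt_le zero_le_two]
  ring

theorem reflect_prod_quadratic {K ι : Type*} [Field K] (s : Finset ι) (c : ι → K)
    (hc : ∀ i ∈ s, c i ≠ 0) :
    (∏ i ∈ s, ((X - C (c i)) * (X - C (c i)⁻¹))).natDegree ≤ 2 * #s ∧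
    reflect (2 * #s) (∏ i ∈ s, ((X - C (c i)) * (X - C (c i)⁻¹))) =
      ∏ i ∈ s, ((X - C (c i)) * (X - C (c i)⁻¹)) := by
  classical
  induction s using Finset.induction_on with
  | empty => simp
  | insert i s hi ih =>
    obtain ⟨hdeg, hrefl⟩ := ih fun k hk => hc k (mem_insert_of_mem hk)
    have hi2 := natDegree_quadratic_le (c i)
    rw [prod_insert hi, card_insert_of_notMem hi, show 2 * (#s + 1) = 2 + 2 * #s by ring]
    exact ⟨natDegree_mul_le_of_le hi2 hdeg, by
      rw [reflect_mul _ _ hi2 hdeg, hrefl, reflect_quadratic (hc i (mem_insert_self i s))]⟩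

theorem reflect_X_sub_one_mul {R : Type*} [CommRing R] {n : ℕ} {p : R[X]}
    (hdeg : p.natDegree ≤ n) (hp : reflect n p = p) :
    reflect (n + 1) ((X - 1) * p) = -((X - 1) * p) := by
  have h1 : (X - 1 : R[X]).natDegree ≤ 1 := by
    simpa using natDegree_X_sub_C_le (1 : R)
  have h2 : reflect 1 (X - 1 : R[X]) = 1 - X := by
    rw [reflect_sub, reflect_one_X, reflect_one, pow_one]
  rw [add_comm, reflect_mul _ _ h1 hdeg, h2, hp]
  ring

theorem coeff_X_pow_sub_sum {R : Type*} [CommRing R] (n : ℕ) (b : ℕ → R) {k : ℕ} (hk : k < n) :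
    ((X : R[X]) ^ (n + 1) - ∑ j ∈ Icc 1 n, C (b j) * X ^ (n - j)).coeff k = -b (n - k) := by
  rw [coeff_sub, coeff_X_pow, if_neg (by omega), finsetSum_coeff,
    sum_eq_single_of_mem (n - k) (by simp; omega)]
  · rw [coeff_C_mul_X_pow, if_pos (by omega), zero_sub]
  · intro j hj hne
    rw [mem_Icc] at hj
    rw [coeff_C_mul_X_pow, if_neg (by omega)]

theorem coeff_X_pow_sub_sum_of_le {R : Type*} [CommRing R] (n : ℕ) (b : ℕ → R) {k : ℕ}
    (hk : n ≤ k) :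
    ((X : R[X]) ^ (n + 1) - ∑ j ∈ Icc 1 n, C (b j) * X ^ (n - j)).coeff k =
      if k = n + 1 then 1 else 0 := by
  rw [coeff_sub, coeff_X_pow, finsetSum_coeff, sum_eq_zero, sub_zero]
  intro j hj
  rw [mem_Icc] at hj
  rw [coeff_C_mul_X_pow, if_neg (by omega)]

/-- Coefficient relations (6.3)–(6.4) of the paper: if the critical-point polynomial
`X^{2q+1} − Σ_{j=1}^{2q} j·a_j·X^{2q−j}` factors as
`(X − 1)·∏_{i=1}^{q} (X − c_i)(X − c_i⁻¹)` with all `c_i ≠ 0`, then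
`a_{2q−1} = 0`, `a_{2q} = 1/(2q)`, and `a_{2q−j} = −((j−1)/(2q−j))·a_{j−1}` for
`2 ≤ j ≤ q`. -/
theorem bers_slice_coefficient_relations_odd
    (q : ℕ) (hq : 2 ≤ q) (a : ℕ → ℂ) (c : ℕ → ℂ)
    (hc : ∀ i, 1 ≤ i → i ≤ q → c i ≠ 0)
    (hid : (X : ℂ[X]) ^ (2 * q + 1) -
        ∑ j ∈ Icc 1 (2 * q), C ((j : ℂ) * a j) * X ^ (2 * q - j) =
      (X - 1) * ∏ i ∈ Icc 1 q, ((X - C (c i)) * (X - C (c i)⁻¹))) :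
    a (2 * q - 1) = 0 ∧ a (2 * q) = 1 / (2 * (q : ℂ)) ∧
    ∀ j : ℕ, 2 ≤ j → j ≤ q →
      a (2 * q - j) = -(((j : ℂ) - 1) / (2 * (q : ℂ) - (j : ℂ))) * a (j - 1) := by
  obtain ⟨hdeg, hrefl⟩ := reflect_prod_quadratic (Icc 1 q) c fun i hi =>
    hc i (mem_Icc.1 hi).1 (mem_Icc.1 hi).2
  rw [Nat.card_Icc, Nat.add_sub_cancel] at hdeg hrefl
  have hanti := reflect_X_sub_one_mul hdeg hrefl
  rw [← hid] at hanti
  have hlow : ∀ k < 2 * q, _ := fun k hk =>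
    coeff_X_pow_sub_sum (2 * q) (fun j => (j : ℂ) * a j) hk
  have hhigh : ∀ k, 2 * q ≤ k → _ := fun k hk =>
    coeff_X_pow_sub_sum_of_le (2 * q) (fun j => (j : ℂ) * a j) hk
  set Q := (X : ℂ[X]) ^ (2 * q + 1) -
    ∑ j ∈ Icc 1 (2 * q), C ((j : ℂ) * a j) * X ^ (2 * q - j)
  have hsymm : ∀ k ≤ 2 * q + 1, Q.coeff (2 * q + 1 - k) = -Q.coeff k := by
    intro k hk
    rw [← coeff_neg, ← hanti, coeff_reflect, revAt_le hk]
  have hcast : ∀ j ≤ 2 * q, ((2 * q - j : ℕ) : ℂ) = 2 * (q : ℂ) - j := by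
    intro j hj
    push_cast [Nat.cast_sub hj]
    rfl
  have hne : ∀ j < 2 * q, 2 * (q : ℂ) - j ≠ 0 := by
    intro j hj
    rw [← hcast j hj.le, Nat.cast_ne_zero]
    omega
  refine ⟨?_, ?_, fun j hj hjq => ?_⟩
  · have h := hsymm 1 (by omega)
    rw [hlow 1 (by omega), hhigh _ (by omega), if_neg (by omega), hcast 1 (by omega), neg_neg] at h
    exact (mul_eq_zero.1 h.symm).resolve_left (hne 1 (by omega))
  · have h := hsymm 0 (by omega)
    rw [hlow 0 (by omega), hhigh _ (by omega), if_pos (by omega), hcast 0 (by omega), neg_neg] at h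
    have h0 := hne 0 (by omega)
    simp only [Nat.cast_zero, sub_zero, Nat.sub_zero] at h h0
    rw [eq_div_iff h0, mul_comm, h]
  · have h := hsymm j (by omega)
    rw [hlow j (by omega), hlow _ (by omega), hcast j (by omega), neg_neg,
      show 2 * q - (2 * q + 1 - j) = j - 1 by omega, Nat.cast_sub (by omega), Nat.cast_one] at h
    have h0 := hne j (by omega)
    field_simp
    linear_combination -h
end

section
/- Let η(z) = 1/z on the Riemann sphere ℂ̂. For i = 1, 2, let 𝔇_i ⊆ ℂ̂ be nonempty open sets with η(𝔇̄_i) = ℂ̂ ∖ 𝔇_i, and let R_i : ℂ̂ → ℂ̂ be rational maps such that R_i restricted to 𝔇̄_i is injective and R₁(𝔇̄₁) = R₂(𝔇̄₂) =: Ω̄. Assume that R₁ ∘ η ∘ (R₁|_{𝔇̄₁})⁻¹ = R₂ ∘ η ∘ (R₂|_{𝔇̄₂})⁻¹ as maps Ω̄ → ℂ̂. Then the two formulas M = (R₂|_{𝔇̄₂})⁻¹ ∘ R₁ on 𝔇̄₁ and M = η ∘ (R₂|_{𝔇̄₂})⁻¹ ∘ R₁ ∘ η on ℂ̂ ∖ 𝔇₁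 agree on ∂𝔇₁ and define a homeomorphism M : ℂ̂ → ℂ̂ which commutes with η, maps 𝔇₁ onto 𝔇₂, is holomorphic on ℂ̂ ∖ ∂𝔇₁, and satisfies R₁ = R₂ ∘ M on all of ℂ̂. -/
open OnePoint Filter Topology Classical

/-- The involution `η(z) = 1/z` of the Riemann sphere `ℂ̂ = ℂ ∪ {∞}`. -/
noncomputable def sphereInv : OnePoint ℂ → OnePoint ℂ
  | ∞ => ((0 : ℂ) : OnePoint ℂ)
  | (z : ℂ) => if z = 0 then ∞ else ((z⁻¹ : ℂ) : OnePoint ℂ)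

/-- Complex conjugation `ι(z) = z̄` extended to the Riemann sphere by `ι(∞) = ∞`. -/
def sphereConj : OnePoint ℂ → OnePoint ℂ
  | ∞ => ∞
  | (z : ℂ) => (((starRingEnd ℂ) z : ℂ) : OnePoint ℂ)

/-- The anti-holomorphic involution `η⁻(z) = 1/z̄` of the Riemann sphere. -/
noncomputable def sphereInvConj : OnePoint ℂ → OnePoint ℂ := sphereInv ∘ sphereConj

/-- The chart parametrization of the Riemann sphere at a point `p`: the identity chart
`w ↦ w` if `p` is finite, and the inverted chart `w ↦ 1/w` (sending `0 ↦ ∞`) if `p = ∞`. -/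
noncomputable def sphereChart (p : OnePoint ℂ) : ℂ → OnePoint ℂ :=
  if p = (∞ : OnePoint ℂ) then (fun w => sphereInv ((w : ℂ) : OnePoint ℂ)) else (fun w => ((w : ℂ) : OnePoint ℂ))

/-- The coordinate of a point of the Riemann sphere in its chart: `z` for a finite point
`z`, and `0` for `∞`. -/
def sphereCoord : OnePoint ℂ → ℂ
  | ∞ => 0
  | (z : ℂ) => z

/-- A self-map of the Riemann sphere is holomorphic at `p` if, read in the charts at `p`
and at `f p`, it is given near `p` by a function of one complex variable that is
analytic at the coordinate of `p`. -/
def SphereHolomorphicAt (f : OnePoint ℂ → OnePoint ℂ) (p : OnePoint ℂ) : Prop :=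
  ∃ g : ℂ → ℂ, AnalyticAt ℂ g (sphereCoord p) ∧
    ∀ᶠ w in 𝓝 (sphereCoord p), f (sphereChart p w) = sphereChart (f p) (g w)

/-- A rational map: a nonconstant holomorphic self-map of the Riemann sphere. -/
def IsRationalMap (R : OnePoint ℂ → OnePoint ℂ) : Prop :=
  (∀ p, SphereHolomorphicAt R p) ∧ ∀ c, R ≠ fun _ => c

/-- The open unit disk `𝔻`, regarded as a subset of the Riemann sphere. -/
def sphereUnitDisk : Set (OnePoint ℂ) := (fun z : ℂ => ((z : ℂ) : OnePoint ℂ)) '' Metric.ball 0 1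

/-- A continuous local right inverse of an analytic function is analytic. -/
theorem AnalyticAt.of_continuous_rightInverse {f s : ℂ → ℂ} {b : ℂ}
    (hf : AnalyticAt ℂ f (s b)) (hs : ∀ᶠ u in 𝓝 b, ContinuousAt s u)
    (hfs : ∀ᶠ u in 𝓝 b, f (s u) = u) : AnalyticAt ℂ s b := by
  have hsb : ContinuousAt s b := hs.self_of_nhds
  have hdf : ∀ᶠ z in 𝓝[≠] (s b), deriv f z ≠ 0 := by
    refine hf.deriv.eventually_eq_zero_or_eventually_ne_zero.resolve_left fun h => ?_
    have hconst : ∀ᶠ z in 𝓝 (s b), f z = f (s b) := by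
      obtain ⟨ε, hε, hball⟩ := Metric.eventually_nhds_iff_ball.1 (h.and hf.eventually_analyticAt)
      refine Metric.eventually_nhds_iff_ball.2 ⟨ε, hε, fun z hz => ?_⟩
      exact Metric.isOpen_ball.is_const_of_deriv_eq_zero
        (convex_ball _ _).isPreconnected
        (fun w hw => (hball w hw).2.differentiableAt.differentiableWithinAt)
        (fun w hw => (hball w hw).1) hz (Metric.mem_ball_self hε)
    have hb : ∀ᶠ u in 𝓝 b, u = b := by
      filter_upwards [hsb.eventually hconst, hfs] with u h₁ h₂
      rw [← h₂, h₁, hfs.self_of_nhds]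
    have hne : ∀ᶠ u in 𝓝[≠] b, u ≠ b := self_mem_nhdsWithin
    obtain ⟨u, hu, hu'⟩ := ((hb.filter_mono nhdsWithin_le_nhds).and hne).exists
    exact hu' hu
  rw [eventually_nhdsWithin_iff] at hdf
  refine Complex.analyticAt_of_differentiable_on_punctured_nhds_of_continuousAt ?_ hsb
  rw [eventually_nhdsWithin_iff]
  filter_upwards [hs, hfs, hfs.eventually_nhds, hsb.eventually hdf,
    hsb.eventually hf.eventually_analyticAt] with u hsu hfu hfu' hdu hau hub
  have hne : s u ≠ s b := fun h => hub <| by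
    rw [Set.mem_singleton_iff, ← hfu, h, hfs.self_of_nhds]
  exact (HasDerivAt.of_local_left_inverse hsu hau.differentiableAt.hasDerivAt
    (hdu hne) hfu').differentiableAt

@[simp] theorem sphereInv_infty : sphereInv ∞ = ((0 : ℂ) : OnePoint ℂ) := rfl

@[simp] theorem sphereInv_zero : sphereInv ((0 : ℂ) : OnePoint ℂ) = ∞ := if_pos rfl

theorem sphereInv_coe {z : ℂ} (hz : z ≠ 0) :
    sphereInv (z : OnePoint ℂ) = ((z⁻¹ : ℂ) : OnePoint ℂ) := if_neg hz

theorem sphereInv_involutive : Function.Involutive sphereInv := by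
  intro p
  induction p using OnePoint.rec with
  | infty => simp
  | coe z =>
    by_cases hz : z = 0
    · simp [hz]
    · rw [sphereInv_coe hz, sphereInv_coe (inv_ne_zero hz), inv_inv]

theorem continuous_sphereInv : Continuous sphereInv := by
  rw [continuous_iff_continuousAt]
  intro p
  induction p using OnePoint.rec with
  | infty =>
    rw [OnePoint.continuousAt_infty', coclosedCompact_eq_cocompact,
      ← Metric.cobounded_eq_cocompact]
    refine ((OnePoint.continuous_coe.tendsto (0 : ℂ)).comp tendsto_inv₀_cobounded).congr' ?_
    filter_upwards [Bornology.isBounded_singleton (x := (0 : ℂ))] with z hz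
    exact (sphereInv_coe hz).symm
  | coe z =>
    rw [OnePoint.continuousAt_coe]
    by_cases hz : z = 0
    · subst hz
      rw [continuousAt_iff_punctured_nhds]
      have h : Tendsto ((↑) : ℂ → OnePoint ℂ) (Bornology.cobounded ℂ) (𝓝 ∞) := by
        rw [Metric.cobounded_eq_cocompact, ← coclosedCompact_eq_cocompact]
        exact OnePoint.tendsto_coe_infty
      simp only [Function.comp_apply, sphereInv_zero]
      refine (h.comp tendsto_inv₀_nhdsNE_zero).congr' ?_
      filter_upwards [self_mem_nhdsWithin] with z hz
      simp [sphereInv_coe hz]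
    · refine ContinuousAt.congr
        (f := fun w : ℂ => ((w⁻¹ : ℂ) : OnePoint ℂ))
        (OnePoint.continuous_coe.continuousAt.comp (continuousAt_inv₀ hz)) ?_
      filter_upwards [eventually_ne_nhds hz] with w hw
      simp [sphereInv_coe hw]

theorem isHomeomorph_sphereInv : IsHomeomorph sphereInv :=
  isHomeomorph_iff_continuous_bijective.2 ⟨continuous_sphereInv, sphereInv_involutive.bijective⟩

@[simp] theorem sphereChart_infty :
    sphereChart ∞ = fun w : ℂ => sphereInv (w : OnePoint ℂ) := if_pos rfl

@[simp] theorem sphereChart_coe (z : ℂ) : sphereChart z = fun w : ℂ => (w : OnePoint ℂ) :=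
  if_neg (OnePoint.coe_ne_infty z)

@[simp] theorem sphereChart_sphereCoord (p : OnePoint ℂ) : sphereChart p (sphereCoord p) = p := by
  induction p using OnePoint.rec with
  | infty => simp [sphereCoord]
  | coe z => simp [sphereCoord]

theorem isOpenEmbedding_sphereChart (p : OnePoint ℂ) : IsOpenEmbedding (sphereChart p) := by
  induction p using OnePoint.rec with
  | infty =>
    rw [sphereChart_infty]
    exact isHomeomorph_sphereInv.isOpenEmbedding.comp OnePoint.isOpenEmbedding_coe
  | coe z =>
    rw [sphereChart_coe]
    exact OnePoint.isOpenEmbedding_coe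

theorem map_sphereChart_nhds (p : OnePoint ℂ) :
    map (sphereChart p) (𝓝 (sphereCoord p)) = 𝓝 p := by
  rw [(isOpenEmbedding_sphereChart p).map_nhds_eq, sphereChart_sphereCoord]

theorem eventually_nhds_sphereChart {p : OnePoint ℂ} {P : OnePoint ℂ → Prop} :
    (∀ᶠ w in 𝓝 (sphereCoord p), P (sphereChart p w)) ↔ ∀ᶠ q in 𝓝 p, P q := by
  rw [← map_sphereChart_nhds p, eventually_map]

namespace SphereHolomorphicAt

/-- The value at the centre of a chart representation is the coordinate of the image point. -/
theorem apply_sphereCoord {f : OnePoint ℂ → OnePoint ℂ} {p : OnePoint ℂ} {g : ℂ → ℂ}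
    (h : ∀ᶠ w in 𝓝 (sphereCoord p), f (sphereChart p w) = sphereChart (f p) (g w)) :
    g (sphereCoord p) = sphereCoord (f p) := by
  apply (isOpenEmbedding_sphereChart (f p)).injective
  rw [← h.self_of_nhds, sphereChart_sphereCoord, sphereChart_sphereCoord]

theorem continuousAt {f : OnePoint ℂ → OnePoint ℂ} {p : OnePoint ℂ}
    (hf : SphereHolomorphicAt f p) : ContinuousAt f p := by
  obtain ⟨g, hg, h⟩ := hf
  have hgp := apply_sphereCoord h
  rw [ContinuousAt, ← map_sphereChart_nhds p, tendsto_map'_iff, ← map_sphereChart_nhds (f p),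
    ← hgp]
  exact (tendsto_map.comp hg.continuousAt).congr' (h.mono fun w hw => hw.symm)

theorem comp {f g : OnePoint ℂ → OnePoint ℂ} {p : OnePoint ℂ}
    (hg : SphereHolomorphicAt g (f p)) (hf : SphereHolomorphicAt f p) :
    SphereHolomorphicAt (g ∘ f) p := by
  obtain ⟨F, hF, hf⟩ := hf
  obtain ⟨G, hG, hg⟩ := hg
  have hFp := apply_sphereCoord hf
  rw [← hFp] at hG hg
  refine ⟨G ∘ F, hG.comp hF, ?_⟩
  filter_upwards [hf, hF.continuousAt.eventually hg] with w h₁ h₂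
  simp only [Function.comp_apply, h₁, h₂]

theorem congr {f g : OnePoint ℂ → OnePoint ℂ} {p : OnePoint ℂ}
    (hf : SphereHolomorphicAt f p) (hfg : f =ᶠ[𝓝 p] g) : SphereHolomorphicAt g p := by
  obtain ⟨F, hF, h⟩ := hf
  refine ⟨F, hF, ?_⟩
  filter_upwards [h, eventually_nhds_sphereChart.2 hfg] with w h₁ h₂
  rw [← h₂, h₁, hfg.self_of_nhds]

/-- A locally injective holomorphic map is open at the given point. -/
theorem nhds_le_map_of_injOn {f : OnePoint ℂ → OnePoint ℂ} {p : OnePoint ℂ} {V : Set (OnePoint ℂ)}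
    (hf : SphereHolomorphicAt f p) (hV : V ∈ 𝓝 p) (hinj : Set.InjOn f V) :
    𝓝 (f p) ≤ map f (𝓝 p) := by
  obtain ⟨g, hg, h⟩ := hf
  have hgp := apply_sphereCoord h
  rcases hg.eventually_constant_or_nhds_le_map_nhds with hc | hmap
  · have hne : ∀ᶠ w in 𝓝[≠] (sphereCoord p), w ≠ sphereCoord p := self_mem_nhdsWithin
    have hVc : ∀ᶠ w in 𝓝 (sphereCoord p), sphereChart p w ∈ V := eventually_nhds_sphereChart.2 hV
    obtain ⟨w, ⟨hw₁, hw₂, hw₃⟩, hw₄⟩ :=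
      (((h.and (hc.and hVc)).filter_mono nhdsWithin_le_nhds).and hne).exists
    refine absurd ((isOpenEmbedding_sphereChart p).injective ?_) hw₄
    rw [sphereChart_sphereCoord]
    refine hinj hw₃ (mem_of_mem_nhds hV) ?_
    rw [hw₁, hw₂, hgp, sphereChart_sphereCoord]
  · calc 𝓝 (f p) = map (sphereChart (f p)) (𝓝 (g (sphereCoord p))) := by
          rw [hgp, map_sphereChart_nhds]
      _ ≤ map (sphereChart (f p)) (map g (𝓝 (sphereCoord p))) := map_mono hmap
      _ = map f (map (sphereChart p) (𝓝 (sphereCoord p))) := by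
          rw [map_map, map_map]
          exact map_congr (h.mono fun w hw => hw.symm)
      _ = map f (𝓝 p) := by rw [map_sphereChart_nhds]

/-- A continuous local right inverse of a holomorphic map of the sphere is holomorphic. -/
theorem of_continuous_rightInverse {f s : OnePoint ℂ → OnePoint ℂ} {q : OnePoint ℂ}
    (hf : SphereHolomorphicAt f (s q)) (hs : ∀ᶠ u in 𝓝 q, ContinuousAt s u)
    (hfs : ∀ᶠ u in 𝓝 q, f (s u) = u) : SphereHolomorphicAt s q := by
  obtain ⟨g, hg, h⟩ := hf
  rw [hfs.self_of_nhds] at h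
  set σ : ℂ → ℂ := fun u => Function.invFun (sphereChart (s q)) (s (sphereChart q u))
  have hrange : ∀ᶠ v in 𝓝 q, s v ∈ Set.range (sphereChart (s q)) :=
    hs.self_of_nhds.eventually <| (isOpenEmbedding_sphereChart (s q)).isOpen_range.mem_nhds
      ⟨_, sphereChart_sphereCoord (s q)⟩
  have hσ : ∀ᶠ u in 𝓝 (sphereCoord q), s (sphereChart q u) = sphereChart (s q) (σ u) := by
    filter_upwards [eventually_nhds_sphereChart.2 hrange] with u hu
    exact (Function.invFun_eq hu).symm
  have hσq := apply_sphereCoord hσ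
  have hcont : ∀ᶠ u in 𝓝 (sphereCoord q), ContinuousAt σ u := by
    filter_upwards [hσ.eventually_nhds, eventually_nhds_sphereChart.2 hs] with u h₁ h₂
    rw [(isOpenEmbedding_sphereChart (s q)).isInducing.continuousAt_iff]
    exact (h₂.comp (isOpenEmbedding_sphereChart q).continuous.continuousAt).congr h₁
  rw [← hσq] at hg h
  refine ⟨σ, hg.of_continuous_rightInverse hcont ?_, hσ⟩
  filter_upwards [hσ, hcont.self_of_nhds.eventually h, eventually_nhds_sphereChart.2 hfs]
    with u h₁ h₂ h₃
  apply (isOpenEmbedding_sphereChart q).injective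
  rw [← h₂, ← h₁, h₃]

end SphereHolomorphicAt

theorem sphereHolomorphicAt_sphereInv (p : OnePoint ℂ) : SphereHolomorphicAt sphereInv p := by
  induction p using OnePoint.rec with
  | infty =>
    refine ⟨id, analyticAt_id, .of_forall fun w => ?_⟩
    simp [sphereInv_involutive _]
  | coe z =>
    by_cases hz : z = 0
    · subst hz
      exact ⟨id, analyticAt_id, .of_forall fun w => by simp⟩
    · refine ⟨fun w => w⁻¹, analyticAt_inv hz, ?_⟩
      filter_upwards [eventually_ne_nhds hz] with w hw
      simp [sphereInv_coe hz, sphereInv_coe hw]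

/-- The inverse of a continuous map injective on a compact set is continuous. -/
theorem IsCompact.continuousOn_invFunOn {X Y : Type*} [TopologicalSpace X] [TopologicalSpace Y]
    [Nonempty X] [T2Space Y] {K : Set X} {f : X → Y} (hK : IsCompact K) (hf : ContinuousOn f K)
    (hinj : Set.InjOn f K) : ContinuousOn (Function.invFunOn f K) (f '' K) := by
  rw [continuousOn_iff_isClosed]
  intro C hC
  refine ⟨f '' (K ∩ C), ((hK.inter_right hC).image_of_continuousOn
    (hf.mono Set.inter_subset_left)).isClosed, ?_⟩
  ext y
  constructor
  · rintro ⟨hyC, x, hx, rfl⟩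
    rw [Set.mem_preimage, hinj.leftInvOn_invFunOn hx] at hyC
    exact ⟨⟨x, ⟨hx, hyC⟩, rfl⟩, x, hx, rfl⟩
  · rintro ⟨⟨x, ⟨hx, hxC⟩, rfl⟩, hy⟩
    exact ⟨by rwa [Set.mem_preimage, hinj.leftInvOn_invFunOn hx], hy⟩

theorem interior_closure_of_sphereInv_image {D : Set (OnePoint ℂ)} (hD : IsOpen D)
    (hinv : sphereInv '' closure D = Dᶜ) : interior (closure D) = D := by
  refine (interior_maximal subset_closure hD).antisymm' fun z hz => ?_
  by_contra hzD
  have hclosure : closure (sphereInv '' D) = Dᶜ := by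
    rw [← hinv]
    exact (isHomeomorph_sphereInv.homeomorph.image_closure D).symm
  rw [← Set.mem_compl_iff, ← hclosure] at hzD
  obtain ⟨_, hy, x, hx, rfl⟩ := mem_closure_iff.1 hzD _ isOpen_interior hz
  have hmem : sphereInv (sphereInv x) ∈ sphereInv '' closure D := ⟨_, interior_subset hy, rfl⟩
  rw [hinv, sphereInv_involutive] at hmem
  exact hmem hx

/-- The transition map between two injective holomorphic parametrizations is holomorphic at
interior points. -/
theorem sphereHolomorphicAt_invFunOn_comp {K₁ K₂ : Set (OnePoint ℂ)}
    {R₁ R₂ : OnePoint ℂ → OnePoint ℂ} (hK₂ : IsCompact K₂)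
    (hR₁ : ∀ p, SphereHolomorphicAt R₁ p) (hR₂ : ∀ p, SphereHolomorphicAt R₂ p)
    (hinj₁ : Set.InjOn R₁ K₁) (hinj₂ : Set.InjOn R₂ K₂) (him : R₁ '' K₁ ⊆ R₂ '' K₂)
    {p : OnePoint ℂ} (hp : K₁ ∈ 𝓝 p) :
    SphereHolomorphicAt (fun z => Function.invFunOn R₂ K₂ (R₁ z)) p ∧
      Function.invFunOn R₂ K₂ (R₁ p) ∈ interior K₂ := by
  set s := Function.invFunOn R₂ K₂
  have hnhds : R₂ '' K₂ ∈ 𝓝 (R₁ p) :=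
    (hR₁ p).nhds_le_map_of_injOn hp hinj₁ <|
      mem_map.2 (mem_of_superset hp fun z hz => him (Set.mem_image_of_mem R₁ hz))
  have hcont : ContinuousOn s (R₂ '' K₂) := hK₂.continuousOn_invFunOn
    (fun z _ => (hR₂ z).continuousAt.continuousWithinAt) hinj₂
  have hs : SphereHolomorphicAt s (R₁ p) := by
    refine (hR₂ _).of_continuous_rightInverse ?_ ?_
    · filter_upwards [eventually_mem_nhds_iff.2 hnhds] with u hu using hcont.continuousAt hu
    · filter_upwards [hnhds] with u hu using Function.invFunOn_eq hu
  refine ⟨hs.comp (hR₁ p), mem_interior_iff_mem_nhds.2 ?_⟩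
  refine hs.nhds_le_map_of_injOn hnhds (Function.invFunOn_injOn_image R₂ K₂) ?_
  exact mem_map.2 (mem_of_superset hnhds fun u hu => Function.invFunOn_mem hu)

/-- The constructive step in the proof of Proposition 5.10 of the paper (uniqueness of
the rational uniformization of a conformal mating): if `(R₁, 𝔇₁)` and `(R₂, 𝔇₂)` are
two rational uniformizations of the same conformal mating
`R₁ ∘ η ∘ (R₁|_{𝔇̄₁})⁻¹ = R₂ ∘ η ∘ (R₂|_{𝔇̄₂})⁻¹` on `Ω̄ = R₁(𝔇̄₁) = R₂(𝔇̄₂)`, where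
`η(𝔇̄ᵢ) = ℂ̂ ∖ 𝔇ᵢ`, then the two formulas `(R₂|_{𝔇̄₂})⁻¹ ∘ R₁` on `𝔇̄₁` and
`η ∘ (R₂|_{𝔇̄₂})⁻¹ ∘ R₁ ∘ η` on `ℂ̂ ∖ 𝔇₁` agree on `∂𝔇₁` and define a homeomorphism
`M` of `ℂ̂` commuting with `η`, mapping `𝔇₁` onto `𝔇₂`, holomorphic off `∂𝔇₁`,
with `R₁ = R₂ ∘ M`. -/
theorem uniqueness_of_rational_uniformization
    (D₁ D₂ : Set (OnePoint ℂ)) (h1ne : D₁.Nonempty) (h2ne : D₂.Nonempty)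
    (h1open : IsOpen D₁) (h2open : IsOpen D₂)
    (h1inv : sphereInv '' closure D₁ = D₁ᶜ)
    (h2inv : sphereInv '' closure D₂ = D₂ᶜ)
    (R₁ R₂ : OnePoint ℂ → OnePoint ℂ)
    (hR₁ : IsRationalMap R₁) (hR₂ : IsRationalMap R₂)
    (hinj₁ : Set.InjOn R₁ (closure D₁)) (hinj₂ : Set.InjOn R₂ (closure D₂))
    (him : R₁ '' closure D₁ = R₂ '' closure D₂)
    (hFeq : ∀ w₁ ∈ closure D₁, ∀ w₂ ∈ closure D₂, R₁ w₁ = R₂ w₂ →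
      R₁ (sphereInv w₁) = R₂ (sphereInv w₂))
    (M : OnePoint ℂ → OnePoint ℂ)
    (hM : M = fun z => if z ∈ closure D₁
      then Function.invFunOn R₂ (closure D₂) (R₁ z)
      else sphereInv (Function.invFunOn R₂ (closure D₂) (R₁ (sphereInv z)))) :
    (∀ z ∈ frontier D₁,
      Function.invFunOn R₂ (closure D₂) (R₁ z)
        = sphereInv (Function.invFunOn R₂ (closure D₂) (R₁ (sphereInv z)))) ∧
    IsHomeomorph M ∧
    (∀ z, M (sphereInv z) = sphereInv (M z)) ∧
    M '' D₁ = D₂ ∧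
    (∀ p ∉ frontier D₁, SphereHolomorphicAt M p) ∧
    R₁ = R₂ ∘ M := by
  set φ := fun z => Function.invFunOn R₂ (closure D₂) (R₁ z)
  have hη := sphereInv_involutive
  have hcompl : ∀ {D : Set (OnePoint ℂ)}, sphereInv '' closure D = Dᶜ →
      ∀ {z}, z ∉ D ↔ sphereInv z ∈ closure D := by
    intro D h z
    rw [← Set.mem_compl_iff, ← h]
    exact ⟨by rintro ⟨y, hy, rfl⟩; rwa [hη], fun hz => ⟨_, hz, hη z⟩⟩
  have hint₁ := interior_closure_of_sphereInv_image h1open h1inv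
  have hint₂ := interior_closure_of_sphereInv_image h2open h2inv
  have hmem : ∀ z ∈ closure D₁, R₁ z ∈ R₂ '' closure D₂ := fun z hz => him ▸ ⟨z, hz, rfl⟩
  have hφmem : ∀ z ∈ closure D₁, φ z ∈ closure D₂ := fun z hz => Function.invFunOn_mem (hmem z hz)
  have hφeq : ∀ z ∈ closure D₁, R₂ (φ z) = R₁ z := fun z hz => Function.invFunOn_eq (hmem z hz)
  have hφunique : ∀ z ∈ closure D₁, ∀ w ∈ closure D₂, R₁ z = R₂ w → φ z = w := fun z hz w hw h =>
    hinj₂ (hφmem z hz) hw ((hφeq z hz).trans h)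
  have hφsurj : ∀ w ∈ closure D₂, ∃ z ∈ closure D₁, φ z = w := by
    intro w hw
    obtain ⟨z, hz, h⟩ : R₂ w ∈ R₁ '' closure D₁ := him ▸ ⟨w, hw, rfl⟩
    exact ⟨z, hz, hφunique z hz w hw h⟩
  have hφinj : Set.InjOn φ (closure D₁) := fun x hx y hy h =>
    hinj₁ hx hy (by rw [← hφeq x hx, ← hφeq y hy, h])
  have hnhds : ∀ z ∈ D₁, closure D₁ ∈ 𝓝 z := fun z hz =>
    mem_of_superset (h1open.mem_nhds hz) subset_closure
  have htrans := fun z hz => sphereHolomorphicAt_invFunOn_comp isClosed_closure.isCompact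
    hR₁.1 hR₂.1 hinj₁ hinj₂ him.le (hnhds z hz)
  have hφD : ∀ z ∈ closure D₁, (φ z ∈ D₂ ↔ z ∈ D₁) := by
    intro z hz
    refine ⟨fun h => ?_, fun h => hint₂ ▸ (htrans z h).2⟩
    have hback := (sphereHolomorphicAt_invFunOn_comp isClosed_closure.isCompact
      hR₂.1 hR₁.1 hinj₂ hinj₁ him.ge
      (mem_of_superset (h2open.mem_nhds h) subset_closure)).2
    rwa [hint₁, hφeq z hz, hinj₁.leftInvOn_invFunOn hz] at hback
  have hφcont : ContinuousOn φ (closure D₁) :=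
    (isClosed_closure.isCompact.continuousOn_invFunOn
      (fun z _ => (hR₂.1 z).continuousAt.continuousWithinAt) hinj₂).comp
      (fun z _ => (hR₁.1 z).continuousAt.continuousWithinAt) hmem
  have hagree : ∀ z ∈ closure D₁, z ∉ D₁ → φ z = sphereInv (φ (sphereInv z)) := by
    intro z hz hzD
    have hw := (hcompl h2inv).1 (mt (hφD z hz).1 hzD)
    rw [hφunique _ ((hcompl h1inv).1 hzD) _ hw
      (hFeq z hz _ (hφmem z hz) (hφeq z hz).symm), hη]
  have hMin : ∀ z ∈ closure D₁, M z = φ z := fun z hz => by rw [hM]; exact if_pos hz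
  have hMout : ∀ z ∉ D₁, M z = sphereInv (φ (sphereInv z)) := by
    intro z hz
    by_cases hzc : z ∈ closure D₁
    · rw [hMin z hzc, hagree z hzc hz]
    · rw [hM]; exact if_neg hzc
  have hηmem : ∀ z ∈ D₁, sphereInv z ∉ D₁ := fun z hz =>
    (hcompl h1inv).2 (by rw [hη]; exact subset_closure hz)
  have hMη : ∀ z, M (sphereInv z) = sphereInv (M z) := by
    intro z
    by_cases hz : z ∈ D₁
    · rw [hMout _ (hηmem z hz), hη, hMin z (subset_closure hz)]
    · rw [hMin _ ((hcompl h1inv).1 hz), hMout z hz, hη]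
  have hMD : ∀ z, M z ∈ D₂ ↔ z ∈ D₁ := by
    intro z
    by_cases hz : z ∈ closure D₁
    · rw [hMin z hz, hφD z hz]
    · have hzD : z ∉ D₁ := fun h => hz (subset_closure h)
      refine iff_of_false (fun h => ?_) hzD
      rw [hMout z hzD] at h
      have hηz := (hcompl h1inv).1 hzD
      exact (hcompl h2inv).2 (by rw [hη]; exact hφmem _ hηz) h
  have hMcont : Continuous M := by
    rw [← continuousOn_univ, ← Set.union_compl_self D₁]
    refine ContinuousOn.mono (s := closure D₁ ∪ D₁ᶜ) ?_ (Set.union_subset_union_left _ subset_closure)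
    refine ContinuousOn.union_of_isClosed (hφcont.congr hMin) ?_ isClosed_closure
      h1open.isClosed_compl
    exact (continuous_sphereInv.comp_continuousOn (hφcont.comp continuous_sphereInv.continuousOn
      fun z hz => (hcompl h1inv).1 hz)).congr hMout
  have hMinj : Function.Injective M := by
    intro x y hxy
    have hD : x ∈ D₁ ↔ y ∈ D₁ := by rw [← hMD, hxy, hMD]
    by_cases hx : x ∈ D₁
    · have hx' := subset_closure hx
      have hy' := subset_closure (hD.1 hx)
      exact hφinj hx' hy' (by rw [← hMin x hx', ← hMin y hy', hxy])
    · have hy := mt hD.2 hx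
      rw [hMout x hx, hMout y hy] at hxy
      exact hη.injective (hφinj ((hcompl h1inv).1 hx) ((hcompl h1inv).1 hy) (hη.injective hxy))
  have hMsurj : Function.Surjective M := by
    intro w
    by_cases hw : w ∈ D₂
    · obtain ⟨z, hz, rfl⟩ := hφsurj w (subset_closure hw)
      exact ⟨z, hMin z hz⟩
    · obtain ⟨z, hz, h⟩ := hφsurj _ ((hcompl h2inv).1 hw)
      exact ⟨sphereInv z, by rw [hMη, hMin z hz, h, hη]⟩
  have hholo : ∀ p ∈ D₁, SphereHolomorphicAt M p := fun p hp =>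
    (htrans p hp).1.congr <| by
      filter_upwards [hnhds p hp] with z hz using (hMin z hz).symm
  refine ⟨fun z hz => ?_, isHomeomorph_iff_continuous_bijective.2 ⟨hMcont, hMinj, hMsurj⟩, hMη,
    ?_, fun p hp => ?_, ?_⟩
  · rw [h1open.frontier_eq] at hz
    exact hagree z hz.1 hz.2
  · rw [← Set.image_preimage_eq D₂ hMsurj]
    exact congrArg _ (Set.ext fun z => (hMD z).symm)
  · by_cases hpD : p ∈ D₁
    · exact hholo p hpD
    have hpc : sphereInv p ∈ D₁ := by
      by_contra h
      have := (hcompl h1inv).1 h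
      rw [hη] at this
      exact hp (h1open.frontier_eq ▸ ⟨this, hpD⟩)
    have hconj : sphereInv ∘ M ∘ sphereInv = M := funext fun z => by simp [hMη, hη (M z)]
    rw [← hconj]
    exact (sphereHolomorphicAt_sphereInv _).comp
      ((hholo _ hpc).comp (sphereHolomorphicAt_sphereInv p))
  · funext z
    by_cases hz : z ∈ D₁
    · rw [Function.comp_apply, hMin z (subset_closure hz), hφeq z (subset_closure hz)]
    · have hηz := (hcompl h1inv).1 hz
      have := hFeq _ hηz _ (hφmem _ hηz) (hφeq _ hηz).symm
      rw [Function.comp_apply, hMout z hz, ← this, hη]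
end
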